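/- Let ε > 0 be fixed. There is a constant C(ε) such that the following holds. Let V₁, V₂ ≥ 1 be real numbers, let q ≥ 1 be an integer, and let a₁, a₂ be nonzero integers coprime to q. Then |N(V₁,V₂;q,a₁,a₂) − N*(V₁,V₂;q)| ≤ C(ε) · q^ε · M(q,a₁,a₂). -/

import Mathlib

open Finset

/-- `Ncount V₁ V₂ q a₁ a₂ = #{(v₁,v₂) : 1 ≤ v₁ ≤ V₁, 1 ≤ v₂ ≤ V₂, a₁v₁ ≡ a₂v₂ (mod q),
gcd(v₁v₂,q)=1}`. -/
noncomputable def Ncount (V₁ V₂ : ℝ) (q : ℕ) (a₁ a₂ : ℤ) : ℕ :=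
  ((Finset.Icc 1 ⌊V₁⌋₊ ×ˢ Finset.Icc 1 ⌊V₂⌋₊).filter (fun v =>
    ((a₁ * v.1 : ℤ) : ZMod q) = ((a₂ * v.2 : ℤ) : ZMod q) ∧
      Nat.Coprime (v.1 * v.2) q)).card

/-- `Nstar V₁ V₂ q = (1/φ(q)) · #{(v₁,v₂) : 1 ≤ v₁ ≤ V₁, 1 ≤ v₂ ≤ V₂, gcd(v₁v₂,q)=1}`. -/
noncomputable def Nstar (V₁ V₂ : ℝ) (q : ℕ) : ℝ :=
  (1 / (Nat.totient q : ℝ)) *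
    (((Finset.Icc 1 ⌊V₁⌋₊ ×ˢ Finset.Icc 1 ⌊V₂⌋₊).filter (fun v =>
      Nat.Coprime (v.1 * v.2) q)).card : ℝ)

/-- `Mweight q a₁ a₂ = ∑_{d ∣ q} d ∑_{0 < |r|,|s| ≤ q/2, a₁s + a₂r ≡ 0 (mod d)}
|r|⁻¹ |s|⁻¹`. -/
noncomputable def Mweight (q : ℕ) (a₁ a₂ : ℤ) : ℝ :=
  ∑ d ∈ q.divisors, (d : ℝ) *
    ∑ r ∈ Finset.Icc (-(q : ℤ)) (q : ℤ), ∑ s ∈ Finset.Icc (-(q : ℤ)) (q : ℤ),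
      if r ≠ 0 ∧ s ≠ 0 ∧ 2 * |r| ≤ (q : ℤ) ∧ 2 * |s| ≤ (q : ℤ) ∧
          (d : ℤ) ∣ (a₁ * s + a₂ * r) then
        (|(r : ℝ)| * |(s : ℝ)|)⁻¹ else 0

theorem exists_card_divisors_le_mul_rpow (ε : ℝ) (hε : 0 < ε) :
    ∃ C : ℝ, 0 ≤ C ∧ ∀ n : ℕ, n ≠ 0 → (#n.divisors : ℝ) ≤ C * (n : ℝ) ^ ε := by
  obtain ⟨P, hP⟩ : ∃ P : ℕ, ∀ p : ℕ, P ≤ p → (2 : ℝ) ≤ (p : ℝ) ^ ε :=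
    Filter.eventually_atTop.1 (((tendsto_rpow_atTop hε).comp
      tendsto_natCast_atTop_atTop).eventually_ge_atTop 2)
  have hl : 0 < ε * Real.log 2 := mul_pos hε (Real.log_pos one_lt_two)
  set B : ℝ := 1 + 1 / (ε * Real.log 2) with hB
  have hB1 : 1 ≤ B := by rw [hB]; linarith [one_div_pos.2 hl]
  have hsmall : ∀ p k : ℕ, 2 ≤ p → ((k : ℝ) + 1) ≤ B * ((p : ℝ) ^ ε) ^ k := by
    intro p k hp
    have hp' : (2 : ℝ) ≤ p := by exact_mod_cast hp
    have h1 : 1 + ε * Real.log 2 ≤ (p : ℝ) ^ ε := by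
      calc 1 + ε * Real.log 2 ≤ Real.exp (ε * Real.log 2) := by
            linarith [Real.add_one_le_exp (ε * Real.log 2)]
        _ = (2 : ℝ) ^ ε := by rw [Real.rpow_def_of_pos two_pos, mul_comm]
        _ ≤ _ := Real.rpow_le_rpow two_pos.le hp' hε.le
    have h2 : 1 + k * (ε * Real.log 2) ≤ ((p : ℝ) ^ ε) ^ k :=
      (one_add_mul_le_pow (by linarith) k).trans (pow_le_pow_left₀ (by linarith) h1 k)
    calc (k : ℝ) + 1 ≤ B * (1 + k * (ε * Real.log 2)) := by
          have hk : (k : ℝ) = 1 / (ε * Real.log 2) * (k * (ε * Real.log 2)) := by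
            field_simp
          rw [hB]
          have : 0 ≤ (k : ℝ) * (ε * Real.log 2) := by positivity
          have : 0 ≤ 1 / (ε * Real.log 2) := by positivity
          nlinarith
      _ ≤ _ := by gcongr
  have hlarge : ∀ p k : ℕ, P ≤ p → ((k : ℝ) + 1) ≤ ((p : ℝ) ^ ε) ^ k := by
    intro p k hp
    have : ((k : ℝ) + 1) ≤ 2 ^ k := by exact_mod_cast Nat.lt_two_pow_self (n := k)
    exact this.trans (pow_le_pow_left₀ two_pos.le (hP p hp) k)
  refine ⟨B ^ P, by positivity, fun n hn => ?_⟩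
  have hcard : (#n.divisors : ℝ) = ∏ p ∈ n.primeFactors, ((n.factorization p : ℝ) + 1) := by
    rw [Nat.card_divisors hn]; push_cast; rfl
  have hpow : (n : ℝ) ^ ε = ∏ p ∈ n.primeFactors, ((p : ℝ) ^ ε) ^ n.factorization p := by
    conv_lhs => rw [← Nat.prod_factorization_pow_eq_self hn]
    rw [Nat.prod_factorization_eq_prod_primeFactors]
    push_cast
    rw [← Real.finsetProd_rpow _ _ (fun i _ => by positivity)]
    refine prod_congr rfl fun p _ => ?_
    rw [← Real.rpow_natCast, ← Real.rpow_mul (by positivity), ← Real.rpow_natCast,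
      ← Real.rpow_mul (by positivity), mul_comm]
  calc (#n.divisors : ℝ) = ∏ p ∈ n.primeFactors, ((n.factorization p : ℝ) + 1) := hcard
    _ ≤ ∏ p ∈ n.primeFactors,
        ((if p < P then B else 1) * ((p : ℝ) ^ ε) ^ n.factorization p) := by
      refine prod_le_prod (fun i _ => by positivity) fun p hp => ?_
      split_ifs with h
      · exact hsmall p _ (Nat.prime_of_mem_primeFactors hp).two_le
      · rw [one_mul]; exact hlarge p _ (not_lt.1 h)
    _ = B ^ #(n.primeFactors.filter (· < P)) * (n : ℝ) ^ ε := by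
      rw [prod_mul_distrib, ← hpow, prod_ite]; simp
    _ ≤ B ^ P * (n : ℝ) ^ ε := by
      gcongr
      calc _ ≤ #(range P) := card_le_card fun p hp => mem_range.2 (mem_filter.1 hp).2
        _ = P := card_range P

/-- The Ramanujan sum, as a function on residue classes modulo `q`. -/
noncomputable def ramanujanSum (q : ℕ) [NeZero q] (x : ZMod q) : ℂ :=
  ∑ t : (ZMod q)ˣ, ZMod.stdAddChar ((t : ZMod q) * x)

/-- The sum of the divisors of `q` that divide the integer `k`. -/
noncomputable def commonDivisorSum (q : ℕ) (k : ℤ) : ℝ :=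
  ∑ d ∈ q.divisors, if (d : ℤ) ∣ k then (d : ℝ) else 0

theorem sum_units_zmod {M : Type*} [AddCommMonoid M] (q : ℕ) [NeZero q] (f : ZMod q → M) :
    ∑ t : (ZMod q)ˣ, f t = ∑ j ∈ range q, if j.Coprime q then f j else 0 := by
  rw [← sum_filter]
  refine sum_bij' (fun t _ => (t : ZMod q).val)
    (fun j hj => ZMod.unitOfCoprime j (mem_filter.1 hj).2) ?_ ?_ ?_ ?_ ?_
  · intro t _
    exact mem_filter.2 ⟨mem_range.2 (ZMod.val_lt _), ZMod.val_coe_unit_coprime t⟩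
  · intros; simp
  · intro t _
    ext
    simp
  · intro j hj
    simp [ZMod.val_cast_of_lt (mem_range.1 (mem_filter.1 hj).1)]
  · intro t _
    simp

theorem sum_divisors_moebius_ite_dvd {q : ℕ} (hq : q ≠ 0) (j : ℕ) :
    (∑ d ∈ q.divisors, if d ∣ j then ArithmeticFunction.moebius d else 0) =
      if j.Coprime q then 1 else 0 := by
  have h : q.divisors.filter (· ∣ j) = (j.gcd q).divisors := by
    ext d
    simp [Nat.dvd_gcd_iff, hq, and_comm]
  rw [← sum_filter, h, ← ArithmeticFunction.coe_zeta_mul_apply,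
    ArithmeticFunction.coe_zeta_mul_moebius, ArithmeticFunction.one_apply]

theorem sum_range_ite_dvd_pow {d e : ℕ} (hd : d ≠ 0) (z : ℂ) :
    (∑ j ∈ range (d * e), if d ∣ j then z ^ j else 0) = ∑ i ∈ range e, (z ^ d) ^ i := by
  rw [← sum_filter]
  symm
  refine sum_bij' (fun i _ => d * i) (fun j _ => j / d) ?_ ?_ ?_ ?_ ?_
  · intro i hi
    simpa [Nat.pos_of_ne_zero hd] using hi
  · intro j hj
    simp only [mem_filter, mem_range] at hj ⊢
    exact Nat.div_lt_of_lt_mul hj.1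
  · intro i _
    exact Nat.mul_div_cancel_left i (Nat.pos_of_ne_zero hd)
  · intro j hj
    exact Nat.mul_div_cancel' (mem_filter.1 hj).2
  · intro i _
    rw [pow_mul]

theorem norm_ramanujanSum_intCast_le (q : ℕ) [NeZero q] (k : ℤ) :
    ‖ramanujanSum q (k : ZMod q)‖ ≤ commonDivisorSum q k := by
  have hq : q ≠ 0 := NeZero.ne q
  set z : ℂ := ZMod.stdAddChar (k : ZMod q) with hz
  have hpow : ∀ j : ℕ, ZMod.stdAddChar ((j : ZMod q) * (k : ZMod q)) = z ^ j := by
    intro j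
    rw [hz, ← AddChar.map_nsmul_eq_pow, nsmul_eq_mul]
  have hzq : z ^ q = 1 := by rw [← hpow]; simp
  have hone : ∀ j : ℕ, z ^ j = 1 ↔ (q : ℤ) ∣ j * k := by
    intro j
    rw [← hpow, ← AddChar.map_zero_eq_one (ZMod.stdAddChar (N := q)),
      ZMod.injective_stdAddChar.eq_iff, ← ZMod.intCast_zmod_eq_zero_iff_dvd]
    push_cast
    rfl
  have hsum : ramanujanSum q (k : ZMod q) = ∑ d ∈ q.divisors,
      ((ArithmeticFunction.moebius d : ℤ) : ℂ) * ∑ i ∈ range (q / d), (z ^ d) ^ i := by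
    rw [ramanujanSum, sum_units_zmod q (fun t => ZMod.stdAddChar (t * (k : ZMod q)))]
    calc _ = ∑ j ∈ range q, ∑ d ∈ q.divisors,
          if d ∣ j then ((ArithmeticFunction.moebius d : ℤ) : ℂ) * z ^ j else 0 := by
          refine sum_congr rfl fun j _ => ?_
          have := congrArg (Int.cast : ℤ → ℂ) (sum_divisors_moebius_ite_dvd hq j)
          push_cast at this
          rw [hpow]
          simp_rw [← ite_zero_mul]
          rw [← sum_mul, this, ite_zero_mul, one_mul]
      _ = _ := by
          rw [sum_comm]
          refine sum_congr rfl fun d hd => ?_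
          rw [← sum_range_ite_dvd_pow (Nat.pos_of_mem_divisors hd).ne',
            Nat.mul_div_cancel' (Nat.dvd_of_mem_divisors hd), mul_sum]
          simp_rw [mul_ite, mul_zero]
  rw [hsum, commonDivisorSum,
    ← Nat.sum_div_divisors q (fun d => if (d : ℤ) ∣ k then (d : ℝ) else 0)]
  refine norm_sum_le_of_le _ fun d hd => ?_
  have hdq := Nat.dvd_of_mem_divisors hd
  obtain ⟨e, rfl⟩ := hdq
  have hd0 : 0 < d := Nat.pos_of_mem_divisors hd
  rw [Nat.mul_div_cancel_left _ hd0]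
  have hmu : ‖((ArithmeticFunction.moebius d : ℤ) : ℂ)‖ ≤ 1 := by
    rw [Complex.norm_intCast]
    exact_mod_cast ArithmeticFunction.abs_moebius_le_one
  rw [norm_mul]
  have hiff : z ^ d = 1 ↔ (e : ℤ) ∣ k := by
    rw [hone]
    push_cast
    exact mul_dvd_mul_iff_left (by exact_mod_cast hd0.ne')
  split_ifs with h
  · rw [hiff.2 h]
    simpa using mul_le_mul_of_nonneg_right hmu (Nat.cast_nonneg e)
  · have hne : z ^ d ≠ 1 := fun h' => h (hiff.1 h')
    rw [geom_sum_eq hne, ← pow_mul, hzq]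
    simp

/-- The exponential sum `∑_{v ≤ n} e(rv/q)` over an initial segment of the positive integers. -/
noncomputable def segmentExpSum (q : ℕ) [NeZero q] (n : ℕ) (r : ZMod q) : ℂ :=
  ∑ v ∈ Icc 1 n, ZMod.stdAddChar (r * (v : ZMod q))

theorem four_mul_abs_valMinAbs_le (q : ℕ) [NeZero q] (r : ZMod q) :
    4 * |(r.valMinAbs : ℝ)| ≤ q * ‖(ZMod.stdAddChar r : ℂ) - 1‖ := by
  have hq : (0 : ℝ) < q := by exact_mod_cast NeZero.pos q
  set k : ℤ := r.valMinAbs with hk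
  have hkq : 2 * |(k : ℝ)| ≤ q := by
    have := ZMod.natAbs_valMinAbs_le r
    rw [← hk] at this
    have h2 : 2 * |k| ≤ (q : ℤ) := by rw [Int.abs_eq_natAbs]; omega
    exact_mod_cast h2
  have hchar : (ZMod.stdAddChar r : ℂ) =
      Complex.exp (Complex.I * ((2 * Real.pi * k / q : ℝ) : ℂ)) := by
    rw [← ZMod.coe_valMinAbs r, ZMod.stdAddChar_coe, ← hk]
    congr 1
    push_cast
    ring
  have habs : |2 * Real.pi * k / q / 2| = Real.pi * |(k : ℝ)| / q := by
    rw [show 2 * Real.pi * k / q / 2 = Real.pi * k / q by ring, abs_div, abs_mul,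
      abs_of_pos Real.pi_pos, abs_of_pos hq]
  have hsin := Real.mul_abs_le_abs_sin (x := 2 * Real.pi * k / q / 2) (by
    rw [habs, div_le_div_iff₀ hq two_pos]
    nlinarith [Real.pi_pos])
  rw [hchar, Complex.norm_exp_I_mul_ofReal_sub_one, Real.norm_eq_abs, abs_mul, abs_two]
  rw [habs] at hsin
  have : 2 / Real.pi * (Real.pi * |(k : ℝ)| / q) = 2 * |(k : ℝ)| / q := by
    field_simp
  rw [this, div_le_iff₀ hq] at hsin
  linarith

theorem norm_segmentExpSum_le (q : ℕ) [NeZero q] (n : ℕ) {r : ZMod q} (hr : r ≠ 0) :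
    ‖segmentExpSum q n r‖ ≤ q / 2 * |(r.valMinAbs : ℝ)|⁻¹ := by
  have hq : (0 : ℝ) < q := by exact_mod_cast NeZero.pos q
  set z : ℂ := ZMod.stdAddChar r with hz
  have hk : 0 < |(r.valMinAbs : ℝ)| := by
    rw [abs_pos]
    exact_mod_cast fun h => hr ((ZMod.valMinAbs_eq_zero r).1 h)
  have hz1 : ‖z‖ = 1 := AddChar.norm_apply _ _
  have hsum : segmentExpSum q n r = z * ∑ i ∈ range n, z ^ i := by
    rw [segmentExpSum, mul_sum, ← Ico_add_one_right_eq_Icc, sum_Ico_eq_sum_range]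
    refine sum_congr rfl fun i _ => ?_
    rw [mul_comm, ← nsmul_eq_mul, AddChar.map_nsmul_eq_pow, add_comm, pow_succ']
  have hmul : ‖segmentExpSum q n r‖ * ‖z - 1‖ ≤ 2 := by
    rw [hsum, ← norm_mul, mul_assoc, geom_sum_mul, norm_mul, hz1, one_mul]
    refine (norm_sub_le _ _).trans ?_
    rw [norm_pow, hz1]
    norm_num
  have h4 := four_mul_abs_valMinAbs_le q r
  rw [← div_eq_mul_inv, le_div_iff₀ hk]
  have := mul_le_mul_of_nonneg_left h4 (norm_nonneg (segmentExpSum q n r))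
  nlinarith

/-- The number of `v ≤ n` in the residue class `x` modulo `q`. -/
def segmentCount (q n : ℕ) (x : ZMod q) : ℕ :=
  #{v ∈ Icc 1 n | ((v : ℕ) : ZMod q) = x}

theorem sum_segmentExpSum_mul_stdAddChar (q : ℕ) [NeZero q] (n : ℕ) (x : ZMod q) :
    ∑ r : ZMod q, segmentExpSum q n r * ZMod.stdAddChar (-(r * x)) =
      q * (segmentCount q n x : ℂ) := by
  have h : ∀ v : ℕ, ∑ r : ZMod q, (ZMod.stdAddChar (r * ((v : ZMod q) - x)) : ℂ) =
      if (v : ZMod q) = x then (q : ℂ) else 0 := by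
    intro v
    rw [AddChar.sum_mulShift _ (ZMod.isPrimitive_stdAddChar q)]
    simp [sub_eq_zero, ZMod.card]
  simp_rw [segmentExpSum, sum_mul]
  rw [sum_comm]
  calc _ = ∑ v ∈ Icc 1 n, if (v : ZMod q) = x then (q : ℂ) else 0 := by
        refine sum_congr rfl fun v _ => ?_
        rw [← h v]
        refine sum_congr rfl fun r _ => ?_
        rw [← AddChar.map_add_eq_mul]
        ring_nf
    _ = _ := by
        rw [segmentCount, ← sum_filter, sum_const, nsmul_eq_mul, mul_comm]

theorem segmentCount_eq_sum (q n : ℕ) (x : ZMod q) :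
    segmentCount q n x = ∑ v ∈ Icc 1 n, if ((v : ℕ) : ZMod q) = x then 1 else 0 := by
  rw [segmentCount, card_filter]

theorem Ncount_eq_sum_units (V₁ V₂ : ℝ) (q : ℕ) [NeZero q] {a₁ a₂ : ℤ} (b₁ b₂ : (ZMod q)ˣ)
    (h₁ : (b₁ : ZMod q) = a₁) (h₂ : (b₂ : ZMod q) = a₂) :
    Ncount V₁ V₂ q a₁ a₂ = ∑ t : (ZMod q)ˣ,
      segmentCount q ⌊V₁⌋₊ (b₂ * t) * segmentCount q ⌊V₂⌋₊ (b₁ * t) := by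
  simp_rw [segmentCount_eq_sum, sum_mul_sum]
  rw [sum_comm, Ncount, card_filter, sum_product]
  refine sum_congr rfl fun v _ => ?_
  rw [sum_comm]
  refine sum_congr rfl fun w _ => ?_
  simp only [← ZMod.isUnit_iff_coprime, Int.cast_mul,
    Int.cast_natCast, ← h₁, ← h₂, ite_zero_mul_ite_zero, mul_one]
  by_cases hv : IsUnit (v : ZMod q)
  · obtain ⟨u, hu⟩ := hv
    have key : ∀ t : (ZMod q)ˣ, ((v : ZMod q) = b₂ * t ∧ (w : ZMod q) = b₁ * t) ↔
        b₂⁻¹ * u = t ∧ (b₁ * (v : ZMod q) = b₂ * w) := by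
      intro t
      have e1 : (v : ZMod q) = b₂ * t ↔ b₂⁻¹ * u = t := by
        rw [← hu, ← Units.val_mul, Units.val_inj, inv_mul_eq_iff_eq_mul]
      rw [e1]
      refine and_congr_right fun ht => ?_
      rw [e1.2 ht, mul_left_comm, Units.mul_right_inj, eq_comm]
    simp_rw [key, ite_and, sum_ite_eq, mem_univ, if_true]
    have hw : b₁ * (v : ZMod q) = b₂ * w → IsUnit (w : ZMod q) := fun h => by
      rw [← hu, ← Units.val_mul] at h
      have h' : IsUnit ((b₂ : ZMod q) * w) := h ▸ Units.isUnit _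
      exact (Units.isUnit_units_mul b₂ _).1 h'
    by_cases h : b₁ * (v : ZMod q) = b₂ * w
    · simp [hw h, ← hu]
    · simp [h]
  · have key : ∀ t : (ZMod q)ˣ, ¬ ((v : ZMod q) = b₂ * t ∧ (w : ZMod q) = b₁ * t) := by
      rintro t ⟨h, -⟩
      exact hv (h ▸ Units.val_mul b₂ t ▸ Units.isUnit _)
    simp [key, hv]

theorem sum_units_segmentCount (q n : ℕ) [NeZero q] :
    ∑ t : (ZMod q)ˣ, segmentCount q n t = #{v ∈ Icc 1 n | Nat.Coprime v q} := by
  simp_rw [segmentCount_eq_sum]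
  rw [sum_comm, card_filter]
  refine sum_congr rfl fun v _ => ?_
  simp only [← ZMod.isUnit_iff_coprime]
  split_ifs with h
  · obtain ⟨u, hu⟩ := h
    simp [← hu, Units.val_inj]
  · have key : ∀ t : (ZMod q)ˣ, (v : ZMod q) ≠ t := fun t ht => h (ht ▸ t.isUnit)
    simp [key]

theorem Nstar_eq_sum_units (V₁ V₂ : ℝ) (q : ℕ) [NeZero q] :
    Nstar V₁ V₂ q = (1 / (Nat.totient q : ℝ)) *
      ((∑ t : (ZMod q)ˣ, segmentCount q ⌊V₁⌋₊ t : ℕ) *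
        (∑ t : (ZMod q)ˣ, segmentCount q ⌊V₂⌋₊ t : ℕ)) := by
  rw [Nstar, sum_units_segmentCount, sum_units_segmentCount]
  simp_rw [Nat.coprime_mul_iff_left]
  rw [filter_product (fun v => Nat.Coprime v q) (fun v => Nat.Coprime v q),
    card_product]
  push_cast
  rfl

theorem mul_sum_units_segmentCount (q n : ℕ) [NeZero q] :
    (q : ℂ) * (∑ t : (ZMod q)ˣ, segmentCount q n t : ℕ) =
      ∑ r : ZMod q, segmentExpSum q n r * ramanujanSum q (-r) := by
  push_cast
  simp_rw [mul_sum, ← sum_segmentExpSum_mul_stdAddChar, ramanujanSum, mul_sum]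
  rw [sum_comm]
  simp_rw [mul_neg, mul_comm]

theorem mul_sum_units_segmentCount_mul (q m n : ℕ) [NeZero q] (b₁ b₂ : ZMod q) :
    (q : ℂ) ^ 2 * (∑ t : (ZMod q)ˣ, segmentCount q m (b₂ * t) * segmentCount q n (b₁ * t) : ℕ) =
      ∑ r : ZMod q, ∑ s : ZMod q, segmentExpSum q m r * segmentExpSum q n s *
        ramanujanSum q (-(b₂ * r + b₁ * s)) := by
  have h : ∀ t : (ZMod q)ˣ,
      (q : ℂ) ^ 2 * (segmentCount q m (b₂ * t) * segmentCount q n (b₁ * t)) =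
      ∑ r : ZMod q, ∑ s : ZMod q, segmentExpSum q m r * segmentExpSum q n s *
        ZMod.stdAddChar ((t : ZMod q) * -(b₂ * r + b₁ * s)) := by
    intro t
    rw [pow_two, mul_mul_mul_comm, ← sum_segmentExpSum_mul_stdAddChar,
      ← sum_segmentExpSum_mul_stdAddChar, sum_mul_sum]
    refine sum_congr rfl fun r _ => sum_congr rfl fun s _ => ?_
    rw [mul_mul_mul_comm, ← AddChar.map_add_eq_mul]
    ring_nf
  push_cast
  rw [mul_sum]
  simp_rw [h, ramanujanSum, mul_sum]
  rw [sum_comm]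
  exact sum_congr rfl fun r _ => sum_comm

theorem ramanujanSum_units_mul (q : ℕ) [NeZero q] (b : (ZMod q)ˣ) (x : ZMod q) :
    ramanujanSum q (b * x) = ramanujanSum q x :=
  Fintype.sum_equiv (Equiv.mulRight b) _ _ fun t => by simp [mul_assoc]

theorem ramanujanSum_zero (q : ℕ) [NeZero q] : ramanujanSum q 0 = Nat.totient q := by
  simp [ramanujanSum, ZMod.card_units_eq_totient]

theorem commonDivisorSum_neg (q : ℕ) (k : ℤ) : commonDivisorSum q (-k) = commonDivisorSum q k := by
  simp_rw [commonDivisorSum, dvd_neg]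

theorem commonDivisorSum_nonneg (q : ℕ) (k : ℤ) : 0 ≤ commonDivisorSum q k :=
  sum_nonneg fun _ _ => by positivity

theorem norm_ramanujanSum_le (q : ℕ) [NeZero q] (r : ZMod q) :
    ‖ramanujanSum q (-r)‖ ≤ commonDivisorSum q r.valMinAbs := by
  have h := norm_ramanujanSum_intCast_le q (-r.valMinAbs)
  rwa [commonDivisorSum_neg, Int.cast_neg, ZMod.coe_valMinAbs] at h

theorem abs_Ncount_sub_Nstar_le (V₁ V₂ : ℝ) (q : ℕ) [NeZero q] {a₁ a₂ : ℤ}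
    (h₁ : IsCoprime a₁ (q : ℤ)) (h₂ : IsCoprime a₂ (q : ℤ)) :
    |(Ncount V₁ V₂ q a₁ a₂ : ℝ) - Nstar V₁ V₂ q| ≤ 1 / 4 *
      ∑ r : ZMod q, ∑ s : ZMod q, |(r.valMinAbs : ℝ)|⁻¹ * |(s.valMinAbs : ℝ)|⁻¹ *
        (commonDivisorSum q (a₁ * s.valMinAbs + a₂ * r.valMinAbs) +
          commonDivisorSum q r.valMinAbs * commonDivisorSum q s.valMinAbs) := by
  have hq : (0 : ℝ) < q := by exact_mod_cast NeZero.pos q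
  have hφ : 0 < Nat.totient q := Nat.totient_pos.2 (NeZero.pos q)
  have hφ' : (Nat.totient q : ℂ) ≠ 0 := by exact_mod_cast hφ.ne'
  obtain ⟨b₁, hb₁⟩ := (ZMod.coe_int_isUnit_iff_isCoprime a₁ q).2 h₁.symm
  obtain ⟨b₂, hb₂⟩ := (ZMod.coe_int_isUnit_iff_isCoprime a₂ q).2 h₂.symm
  set K : ZMod q → ZMod q → ℂ := fun r s => ramanujanSum q (-(b₂ * r + b₁ * s)) -
    ramanujanSum q (-r) * ramanujanSum q (-s) / Nat.totient q with hK
  have hK0 : ∀ s, K 0 s = 0 := by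
    intro s
    simp only [hK, mul_zero, zero_add, neg_zero, ramanujanSum_zero]
    rw [← mul_neg, ramanujanSum_units_mul, mul_div_cancel_left₀ _ hφ', sub_self]
  have hK0' : ∀ r, K r 0 = 0 := by
    intro r
    simp only [hK, mul_zero, add_zero, neg_zero, ramanujanSum_zero]
    rw [← mul_neg, ramanujanSum_units_mul, mul_div_cancel_right₀ _ hφ', sub_self]
  have hKle : ∀ r s, ‖K r s‖ ≤ commonDivisorSum q (a₁ * s.valMinAbs + a₂ * r.valMinAbs) +
      commonDivisorSum q r.valMinAbs * commonDivisorSum q s.valMinAbs := by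
    intro r s
    refine (norm_sub_le _ _).trans (add_le_add ?_ ?_)
    · have h := norm_ramanujanSum_intCast_le q (-(a₁ * s.valMinAbs + a₂ * r.valMinAbs))
      rw [commonDivisorSum_neg] at h
      push_cast at h
      rwa [← hb₁, ← hb₂, add_comm] at h
    · rw [norm_div, norm_mul, Complex.norm_natCast]
      refine (div_le_self (by positivity) (by exact_mod_cast hφ)).trans ?_
      exact mul_le_mul (norm_ramanujanSum_le q r) (norm_ramanujanSum_le q s) (norm_nonneg _)
        (commonDivisorSum_nonneg _ _)
  have hid : (q : ℂ) ^ 2 * (((Ncount V₁ V₂ q a₁ a₂ : ℝ) - Nstar V₁ V₂ q : ℝ) : ℂ) =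
      ∑ r : ZMod q, ∑ s : ZMod q,
        segmentExpSum q ⌊V₁⌋₊ r * segmentExpSum q ⌊V₂⌋₊ s * K r s := by
    simp only [hK, mul_sub, sum_sub_distrib]
    rw [← mul_sum_units_segmentCount_mul, ← Ncount_eq_sum_units V₁ V₂ q b₁ b₂ hb₁ hb₂,
      Nstar_eq_sum_units, Complex.ofReal_sub, mul_sub]
    congr 1
    calc _ = ((q : ℂ) * (∑ t : (ZMod q)ˣ, segmentCount q ⌊V₁⌋₊ t : ℕ)) *
          ((q : ℂ) * (∑ t : (ZMod q)ˣ, segmentCount q ⌊V₂⌋₊ t : ℕ)) / Nat.totient q := by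
          push_cast
          ring
      _ = _ := by
          rw [mul_sum_units_segmentCount, mul_sum_units_segmentCount, sum_mul_sum, sum_div]
          refine sum_congr rfl fun r _ => ?_
          rw [sum_div]
          refine sum_congr rfl fun s _ => ?_
          ring
  have hnorm : (q : ℝ) ^ 2 * |(Ncount V₁ V₂ q a₁ a₂ : ℝ) - Nstar V₁ V₂ q| ≤
      ∑ r : ZMod q, ∑ s : ZMod q, (q : ℝ) ^ 2 * (1 / 4) *
        (|(r.valMinAbs : ℝ)|⁻¹ * |(s.valMinAbs : ℝ)|⁻¹ *
        (commonDivisorSum q (a₁ * s.valMinAbs + a₂ * r.valMinAbs) +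
          commonDivisorSum q r.valMinAbs * commonDivisorSum q s.valMinAbs)) := by
    have h := congrArg norm hid
    rw [norm_mul, norm_pow, Complex.norm_natCast, Complex.norm_real, Real.norm_eq_abs] at h
    rw [h]
    refine norm_sum_le_of_le _ fun r _ => norm_sum_le_of_le _ fun s _ => ?_
    rcases eq_or_ne r 0 with rfl | hr
    · simp [hK0]
    rcases eq_or_ne s 0 with rfl | hs
    · simp [hK0']
    rw [norm_mul, norm_mul]
    calc _ ≤ (q / 2 * |(r.valMinAbs : ℝ)|⁻¹) * (q / 2 * |(s.valMinAbs : ℝ)|⁻¹) *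
          (commonDivisorSum q (a₁ * s.valMinAbs + a₂ * r.valMinAbs) +
          commonDivisorSum q r.valMinAbs * commonDivisorSum q s.valMinAbs) := by
          gcongr
          · exact norm_segmentExpSum_le q _ hr
          · exact norm_segmentExpSum_le q _ hs
          · exact hKle r s
      _ = _ := by ring
  simp_rw [← mul_sum] at hnorm
  rw [mul_assoc] at hnorm
  exact le_of_mul_le_mul_left hnorm (by positivity)

theorem sum_valMinAbs_le (q : ℕ) [NeZero q] {g : ℤ → ℝ} (hg : ∀ k, 0 ≤ g k) :
    ∑ r : ZMod q, g r.valMinAbs ≤ ∑ k ∈ Icc (-(q : ℤ)) q, g k := by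
  rw [← sum_image (s := univ) (g := ZMod.valMinAbs) (f := g)
    ZMod.injective_valMinAbs.injOn]
  refine sum_le_sum_of_subset_of_nonneg (fun k hk => ?_) fun k _ _ => hg k
  obtain ⟨r, -, rfl⟩ := mem_image.1 hk
  have := ZMod.natAbs_valMinAbs_le r
  rw [mem_Icc]
  omega

theorem sum_valMinAbs_le_Mweight (q : ℕ) [NeZero q] (a₁ a₂ : ℤ) :
    ∑ r : ZMod q, ∑ s : ZMod q, |(r.valMinAbs : ℝ)|⁻¹ * |(s.valMinAbs : ℝ)|⁻¹ *
      commonDivisorSum q (a₁ * s.valMinAbs + a₂ * r.valMinAbs) ≤ Mweight q a₁ a₂ := by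
  set G : ℤ → ℤ → ℝ := fun r s => ∑ d ∈ q.divisors, (d : ℝ) *
    if r ≠ 0 ∧ s ≠ 0 ∧ 2 * |r| ≤ (q : ℤ) ∧ 2 * |s| ≤ (q : ℤ) ∧ (d : ℤ) ∣ (a₁ * s + a₂ * r) then
      (|(r : ℝ)| * |(s : ℝ)|)⁻¹ else 0 with hG
  have hG0 : ∀ r s, 0 ≤ G r s := fun r s => sum_nonneg fun _ _ => by positivity
  have hM : Mweight q a₁ a₂ = ∑ r ∈ Icc (-(q : ℤ)) q, ∑ s ∈ Icc (-(q : ℤ)) q, G r s := by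
    simp only [Mweight, hG, mul_sum]
    rw [sum_comm]
    exact sum_congr rfl fun r _ => sum_comm
  have hle : ∀ r : ZMod q, 2 * |r.valMinAbs| ≤ (q : ℤ) := fun r => by
    have := ZMod.natAbs_valMinAbs_le r
    rw [Int.abs_eq_natAbs]
    omega
  have hterm : ∀ r s : ZMod q, |(r.valMinAbs : ℝ)|⁻¹ * |(s.valMinAbs : ℝ)|⁻¹ *
      commonDivisorSum q (a₁ * s.valMinAbs + a₂ * r.valMinAbs) =
      G r.valMinAbs s.valMinAbs := by
    intro r s
    simp only [hG, commonDivisorSum, mul_sum, hle, true_and]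
    refine sum_congr rfl fun d _ => ?_
    by_cases hr : r.valMinAbs = 0
    · simp [hr]
    by_cases hs : s.valMinAbs = 0
    · simp [hs]
    simp only [ne_eq, hr, hs, not_false_eq_true, true_and]
    split_ifs
    · rw [mul_inv]; ring
    · simp
  simp_rw [hterm]
  rw [hM]
  calc _ ≤ ∑ r : ZMod q, ∑ s ∈ Icc (-(q : ℤ)) q, G r.valMinAbs s :=
        sum_le_sum fun r _ => sum_valMinAbs_le q fun s => hG0 _ s
    _ ≤ _ := sum_valMinAbs_le q (g := fun r => ∑ s ∈ Icc (-(q : ℤ)) q, G r s)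
        fun r => sum_nonneg fun s _ => hG0 r s

theorem one_le_commonDivisorSum {q : ℕ} (hq : q ≠ 0) (k : ℤ) : 1 ≤ commonDivisorSum q k := by
  have := single_le_sum (f := fun d : ℕ => if (d : ℤ) ∣ k then (d : ℝ) else 0)
    (fun d _ => by positivity) (Nat.one_mem_divisors.2 hq)
  simpa [commonDivisorSum] using this

theorem one_le_Mweight {q : ℕ} (hq : 2 ≤ q) (a₁ a₂ : ℤ) : 1 ≤ Mweight q a₁ a₂ := by
  have : NeZero q := ⟨by omega⟩
  have h1 : (1 : ZMod q).valMinAbs = 1 := by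
    have := ZMod.valMinAbs_natCast_of_le_half (n := q) (a := 1) (by omega)
    simpa using this
  have hnn : ∀ r s : ZMod q, 0 ≤ |(r.valMinAbs : ℝ)|⁻¹ * |(s.valMinAbs : ℝ)|⁻¹ *
      commonDivisorSum q (a₁ * s.valMinAbs + a₂ * r.valMinAbs) := fun r s =>
    mul_nonneg (by positivity) (commonDivisorSum_nonneg _ _)
  refine le_trans ?_ (sum_valMinAbs_le_Mweight q a₁ a₂)
  refine le_trans ?_ (single_le_sum (fun r _ => sum_nonneg fun s _ => hnn r s)
    (mem_univ (1 : ZMod q)))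
  refine le_trans ?_ (single_le_sum (fun s _ => hnn 1 s) (mem_univ (1 : ZMod q)))
  rw [h1]
  simpa using one_le_commonDivisorSum (by omega) _

theorem sum_Icc_neg_natAbs_le (n : ℕ) {h : ℕ → ℝ} (hh : ∀ m, 0 ≤ h m) :
    ∑ k ∈ Icc (-(n : ℤ)) n, h k.natAbs ≤ 2 * ∑ m ∈ range (n + 1), h m := by
  have hsub : Icc (-(n : ℤ)) n ⊆
      (range (n + 1)).image (fun m : ℕ => (m : ℤ)) ∪
        (range (n + 1)).image (fun m : ℕ => -(m : ℤ)) := by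
    intro k hk
    rw [mem_Icc] at hk
    simp only [mem_union, mem_image, mem_range]
    rcases Int.natAbs_eq k with h | h
    · exact Or.inl ⟨k.natAbs, by omega, h.symm⟩
    · exact Or.inr ⟨k.natAbs, by omega, h.symm⟩
  refine (sum_le_sum_of_subset_of_nonneg hsub fun k _ _ => hh _).trans ?_
  have hinter := sum_union_inter (s₁ := (range (n + 1)).image (fun m : ℕ => (m : ℤ)))
    (s₂ := (range (n + 1)).image (fun m : ℕ => -(m : ℤ))) (f := fun k : ℤ => h k.natAbs)
  have h0 : 0 ≤ ∑ k ∈ (range (n + 1)).image (fun m : ℕ => (m : ℤ)) ∩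
      (range (n + 1)).image (fun m : ℕ => -(m : ℤ)), h k.natAbs := sum_nonneg fun _ _ => hh _
  rw [sum_image (f := fun k : ℤ => h k.natAbs) (fun a _ b _ hab => by simpa using hab),
    sum_image (f := fun k : ℤ => h k.natAbs) (fun a _ b _ hab => by simpa using hab)] at hinter
  simp only [Int.natAbs_neg, Int.natAbs_natCast] at hinter
  linarith

theorem sum_range_ite_dvd_le {d n : ℕ} (hd : d ≠ 0) :
    ∑ m ∈ range (n + 1), (if d ∣ m then (d : ℝ) * (m : ℝ)⁻¹ else 0) ≤ 1 + Real.log n := by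
  have hd' : (d : ℝ) ≠ 0 := by exact_mod_cast hd
  have hharm : ∑ j ∈ range (n + 1), (j : ℝ)⁻¹ ≤ 1 + Real.log n := by
    have h := harmonic_le_one_add_log n
    rw [harmonic] at h
    push_cast at h
    rw [sum_range_succ']
    push_cast
    simpa using h
  refine le_trans ?_ hharm
  rw [← sum_filter]
  calc _ = ∑ m ∈ (range (n + 1)).filter (d ∣ ·), ((m / d : ℕ) : ℝ)⁻¹ := by
        refine sum_congr rfl fun m hm => ?_
        rw [Nat.cast_div (mem_filter.1 hm).2 hd', inv_div, div_eq_mul_inv]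
    _ = ∑ j ∈ ((range (n + 1)).filter (d ∣ ·)).image (· / d), (j : ℝ)⁻¹ := by
        rw [sum_image]
        intro a ha b hb hab
        exact (Nat.div_left_inj (mem_filter.1 ha).2 (mem_filter.1 hb).2).1 hab
    _ ≤ _ := by
        refine sum_le_sum_of_subset_of_nonneg (fun j hj => ?_) fun j _ _ => by positivity
        obtain ⟨m, hm, rfl⟩ := mem_image.1 hj
        have := mem_range.1 (mem_filter.1 hm).1
        exact mem_range.2 ((Nat.div_le_self m d).trans_lt this)

theorem sum_inv_abs_mul_commonDivisorSum_le (q : ℕ) [NeZero q] :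
    ∑ r : ZMod q, |(r.valMinAbs : ℝ)|⁻¹ * commonDivisorSum q r.valMinAbs ≤
      2 * (#q.divisors * (1 + Real.log q)) := by
  calc _ ≤ ∑ k ∈ Icc (-(q : ℤ)) q, |(k : ℝ)|⁻¹ * commonDivisorSum q k :=
        sum_valMinAbs_le q (g := fun k => |(k : ℝ)|⁻¹ * commonDivisorSum q k)
          fun k => mul_nonneg (by positivity) (commonDivisorSum_nonneg _ _)
    _ = ∑ d ∈ q.divisors, ∑ k ∈ Icc (-(q : ℤ)) q,
          if d ∣ k.natAbs then (d : ℝ) * (k.natAbs : ℝ)⁻¹ else 0 := by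
        simp only [commonDivisorSum, mul_sum]
        rw [sum_comm]
        refine sum_congr rfl fun d _ => sum_congr rfl fun k _ => ?_
        rw [mul_ite, mul_zero, mul_comm, Nat.cast_natAbs, Int.cast_abs]
        simp only [Int.natCast_dvd]
    _ ≤ ∑ d ∈ q.divisors, 2 * (1 + Real.log q) := by
        refine sum_le_sum fun d hd => ?_
        refine (sum_Icc_neg_natAbs_le q (h := fun m => if d ∣ m then (d : ℝ) * (m : ℝ)⁻¹ else 0)
          fun m => by positivity).trans ?_
        exact mul_le_mul_of_nonneg_left
          (sum_range_ite_dvd_le (Nat.pos_of_mem_divisors hd).ne') two_pos.le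
    _ = _ := by
        rw [sum_const, nsmul_eq_mul]
        ring

theorem stmt10 (ε : ℝ) (hε : 0 < ε) :
    ∃ C : ℝ, ∀ (V₁ V₂ : ℝ) (q : ℕ) (a₁ a₂ : ℤ), 1 ≤ V₁ → 1 ≤ V₂ → 1 ≤ q →
      a₁ ≠ 0 → a₂ ≠ 0 → IsCoprime a₁ (q : ℤ) → IsCoprime a₂ (q : ℤ) →
      |(Ncount V₁ V₂ q a₁ a₂ : ℝ) - Nstar V₁ V₂ q| ≤
        C * (q : ℝ) ^ ε * Mweight q a₁ a₂ := by
  have hε4 : 0 < ε / 4 := by positivity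
  obtain ⟨D, hD0, hD⟩ := exists_card_divisors_le_mul_rpow (ε / 4) hε4
  set E : ℝ := 2 * (D * (1 + 1 / (ε / 4))) with hE
  refine ⟨1 / 4 * (1 + E ^ 2), fun V₁ V₂ q a₁ a₂ _ _ hq _ _ h₁ h₂ => ?_⟩
  have : NeZero q := ⟨by omega⟩
  have hq1 : (1 : ℝ) ≤ q := by exact_mod_cast hq
  set S : ℝ := ∑ r : ZMod q, |(r.valMinAbs : ℝ)|⁻¹ * commonDivisorSum q r.valMinAbs with hS
  have hS0 : 0 ≤ S := sum_nonneg fun r _ =>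
    mul_nonneg (by positivity) (commonDivisorSum_nonneg _ _)
  have hmain := abs_Ncount_sub_Nstar_le V₁ V₂ q h₁ h₂
  simp_rw [mul_add, sum_add_distrib] at hmain
  have hSS : ∑ r : ZMod q, ∑ s : ZMod q, |(r.valMinAbs : ℝ)|⁻¹ * |(s.valMinAbs : ℝ)|⁻¹ *
      (commonDivisorSum q r.valMinAbs * commonDivisorSum q s.valMinAbs) = S ^ 2 := by
    rw [pow_two, hS, sum_mul_sum]
    exact sum_congr rfl fun r _ => sum_congr rfl fun s _ => by ring
  rw [hSS] at hmain
  have hM := sum_valMinAbs_le_Mweight q a₁ a₂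
  have hM0 : 0 ≤ Mweight q a₁ a₂ := le_trans
    (sum_nonneg fun r _ => sum_nonneg fun s _ =>
      mul_nonneg (by positivity) (commonDivisorSum_nonneg _ _)) hM
  have hqε : 1 ≤ (q : ℝ) ^ ε := Real.one_le_rpow hq1 hε.le
  have hSle : S ^ 2 ≤ E ^ 2 * (q : ℝ) ^ ε * Mweight q a₁ a₂ := by
    rcases hq.eq_or_lt with rfl | hq2
    · have hS1 : S = 0 := by
        rw [hS]
        refine sum_eq_zero fun r _ => ?_
        rw [Subsingleton.elim r 0]
        simp
      rw [hS1, zero_pow two_ne_zero]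
      exact mul_nonneg (by positivity) hM0
    · have hlog : 1 + Real.log q ≤ (1 + 1 / (ε / 4)) * (q : ℝ) ^ (ε / 4) := by
        have h1 := Real.log_le_rpow_div (x := q) (by positivity) hε4
        have h2 := Real.one_le_rpow hq1 hε4.le
        rw [add_mul, one_mul, one_div_mul_eq_div]
        exact add_le_add h2 h1
      have hSE : S ≤ E * ((q : ℝ) ^ (ε / 4)) ^ 2 := by
        refine (sum_inv_abs_mul_commonDivisorSum_le q).trans ?_
        calc _ ≤ 2 * ((D * (q : ℝ) ^ (ε / 4)) * ((1 + 1 / (ε / 4)) * (q : ℝ) ^ (ε / 4))) := by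
              gcongr
              exact hD q (by omega)
          _ = _ := by rw [hE]; ring
      calc S ^ 2 ≤ (E * ((q : ℝ) ^ (ε / 4)) ^ 2) ^ 2 := pow_le_pow_left₀ hS0 hSE 2
        _ = E ^ 2 * (q : ℝ) ^ ε := by
            rw [mul_pow, ← pow_mul, ← Real.rpow_natCast _ (2 * 2), ← Real.rpow_mul (by positivity)]
            norm_num
        _ ≤ _ := le_mul_of_one_le_right (by positivity) (one_le_Mweight hq2 a₁ a₂)
  have hMq : Mweight q a₁ a₂ ≤ (q : ℝ) ^ ε * Mweight q a₁ a₂ := le_mul_of_one_le_left hM0 hqε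
  linarith
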